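/- Let M = (X^(n)) be a finite-state, homogeneous, irreducible Markov chain with state space 𝒳, transition matrix P and invariant distribution π = [p_j]_{j∈𝒳}, and let 𝒳 = A_1 ⊔ A_2 ⊔ … ⊔ A_m be any partition of 𝒳 into nonempty disjoint subsets. For any η > 0 there exist ε₀ > 0 and N₀ ∈ ℕ⁺ such that for all 0 < ε < ε₀, all n > N₀ and every x = [x^(1),…,x^(n)] ∈ S_ε(n,P), the set S_ε(x) = { [y^(1),…,y^(n)] ∈ S_ε(n,P) : y^(l) ∈ A_k ⇔ x^(l) ∈ A_k for all 1 ≤ l ≤ n and 1 ≤ k ≤ m } satisfies |S_ε(x)| < exp₂{ n [ ∑_{k=1}^m (∑_{j∈A_k} p_j) · H(S_k | π_k) + η ] }, where S_k is the stochastic complement of P_{A_k,A_k} in P and π_k = [p_i/∑_{j∈A_k} p_j]_{i∈A_k} is its invariant distribution. -/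

import Mathlib

open Finset

/-- `N(i,j;x)`: number of occurrences of the consecutive pair `[i, j]` in the sequence `x`. -/
noncomputable def pairCount {X : Type*} [DecidableEq X] (x : List X) (i j : X) : ℕ :=
  (x.zip x.tail).count (i, j)

/-- `N(i;x) = ∑_j N(i,j;x)`. -/
noncomputable def stateCount {X : Type*} [Fintype X] [DecidableEq X] (x : List X) (i : X) : ℕ :=
  ∑ j, pairCount x i j

/-- `x` is strongly Markov ε-typical with respect to the stochastic matrix `Q`
whose invariant distribution is `q`. -/
def SMTypical {X : Type*} [Fintype X] [DecidableEq X]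
    (Q : X → X → ℝ) (q : X → ℝ) (ε : ℝ) (x : List X) : Prop :=
  ∀ i j : X,
    |(pairCount x i j : ℝ) / (stateCount x i : ℝ) - Q i j| < ε ∧
    |(stateCount x i : ℝ) / (x.length : ℝ) - q i| < ε

/-- `P` is a stochastic matrix. -/
def IsStochasticMat {X : Type*} [Fintype X] (P : X → X → ℝ) : Prop :=
  (∀ i j, 0 ≤ P i j) ∧ ∀ i, ∑ j, P i j = 1

/-- `P` is irreducible: there is no nonempty `A ⊊ X` with `P_{A,Aᶜ} = 0`. -/
def IsIrreducibleMat {X : Type*} [Fintype X] (P : X → X → ℝ) : Prop :=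
  ∀ A : Finset X, A.Nonempty → A ≠ Finset.univ → ∃ i ∈ A, ∃ j ∉ A, P i j ≠ 0

/-- `π` is an invariant (stationary) distribution of `P`. -/
def IsInvariantDist {X : Type*} [Fintype X] (P : X → X → ℝ) (π : X → ℝ) : Prop :=
  (∀ i, 0 ≤ π i) ∧ ∑ i, π i = 1 ∧ ∀ j, ∑ i, π i * P i j = π j

/-- Probability that the stationary Markov chain with initial (invariant) distribution `π`
and transition matrix `P` emits the finite path `x`. -/
noncomputable def pathProb {X : Type*} (π : X → ℝ) (P : X → X → ℝ) (x : List X) : ℝ :=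
  (x.head?.elim 1 π) * ((x.zip x.tail).map fun p => P p.1 p.2).prod

/-- `H(P|π) = -∑_{i,j} π_i P_{ij} log₂ P_{ij}`. -/
noncomputable def mcCondEnt {X : Type*} [Fintype X] (P : X → X → ℝ) (π : X → ℝ) : ℝ :=
  -∑ i, ∑ j, π i * P i j * Real.logb 2 (P i j)

/-- The stochastic complement `S_A = P_{A,A} + P_{A,Aᶜ} (1 - P_{Aᶜ,Aᶜ})⁻¹ P_{Aᶜ,A}`
of `P_{A,A}` in `P`. -/
noncomputable def stochComp {X : Type*} [Fintype X] [DecidableEq X]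
    (P : X → X → ℝ) (A : Finset X) :
    {i : X // i ∈ A} → {i : X // i ∈ A} → ℝ := fun i j =>
  ((Matrix.of fun a b : {i : X // i ∈ A} => P a.1 b.1) +
    (Matrix.of fun (a : {i : X // i ∈ A}) (b : {i : X // i ∉ A}) => P a.1 b.1) *
      (1 - Matrix.of fun a b : {i : X // i ∉ A} => P a.1 b.1)⁻¹ *
      (Matrix.of fun (a : {i : X // i ∉ A}) (b : {i : X // i ∈ A}) => P a.1 b.1)) i j

/-- The subsequence of `x` formed by all entries lying in `A`, in their original order. -/
noncomputable def subListIn {X : Type*} [DecidableEq X] (x : List X) (A : Finset X) :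
    List {i : X // i ∈ A} :=
  x.filterMap fun a => if h : a ∈ A then some ⟨a, h⟩ else none

/-- `x` is Supremus ε-typical with respect to `P`: for every nonempty `A ⊆ X` the
subsequence `x_A` is strongly Markov ε-typical with respect to the stochastic
complement `S_A` (whose invariant distribution is the normalized restriction of `π`). -/
def SupTypical {X : Type*} [Fintype X] [DecidableEq X]
    (P : X → X → ℝ) (π : X → ℝ) (ε : ℝ) (x : List X) : Prop :=
  ∀ A : Finset X, A.Nonempty →
    SMTypical (stochComp P A) (fun i : {i : X // i ∈ A} => π i.1 / ∑ j ∈ A, π j) ε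
      (subListIn x A)

/-- `H(S_A | π_A)`: the conditional entropy of the stochastic complement `S_A`
with respect to its invariant distribution `π_A`. -/
noncomputable def scCondEnt {X : Type*} [Fintype X] [DecidableEq X]
    (P : X → X → ℝ) (π : X → ℝ) (A : Finset X) : ℝ :=
  -∑ i : {i : X // i ∈ A}, ∑ j : {i : X // i ∈ A},
    (π i.1 / ∑ l ∈ A, π l) * stochComp P A i j * Real.logb 2 (stochComp P A i j)

lemma pairCount_cons_cons {X : Type*} [DecidableEq X] (a b : X) (l : List X) (i j : X) :
    pairCount (a :: b :: l) i j = pairCount (b :: l) i j + if a = i ∧ b = j then 1 else 0 := by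
  simp [pairCount, List.count_cons]

lemma stateCount_cons_cons {X : Type*} [Fintype X] [DecidableEq X] (a b : X) (l : List X) (i : X) :
    stateCount (a :: b :: l) i = stateCount (b :: l) i + if a = i then 1 else 0 := by
  simp only [stateCount, pairCount_cons_cons, Finset.sum_add_distrib]
  by_cases h : a = i <;> simp [h]

/-- `stateCount` omits only the last entry of the list. -/
lemma stateCount_le_count_le {X : Type*} [Fintype X] [DecidableEq X] (l : List X) (i : X) :
    stateCount l i ≤ l.count i ∧ l.count i ≤ stateCount l i + 1 := by
  induction l with
  | nil => simp [stateCount, pairCount]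
  | cons a l ih =>
    cases l with
    | nil =>
      simp only [stateCount, pairCount, List.count_cons]
      by_cases h : a = i <;> simp [h]
    | cons b l =>
      rw [stateCount_cons_cons, List.count_cons]
      simp only [beq_iff_eq]
      omega

lemma pairCount_le_length {X : Type*} [DecidableEq X] (l : List X) (i j : X) :
    pairCount l i j ≤ l.length := by
  refine List.count_le_length.trans ?_
  simp [List.length_zip]

lemma subListIn_cons_of_mem {X : Type*} [DecidableEq X] {a : X} {A : Finset X} (h : a ∈ A)
    (l : List X) : subListIn (a :: l) A = ⟨a, h⟩ :: subListIn l A := by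
  simp [subListIn, h]

lemma subListIn_cons_of_notMem {X : Type*} [DecidableEq X] {a : X} {A : Finset X} (h : a ∉ A)
    (l : List X) : subListIn (a :: l) A = subListIn l A := by
  simp [subListIn, h]

lemma count_subListIn {X : Type*} [DecidableEq X] (l : List X) (A : Finset X)
    [BEq {i : X // i ∈ A}] [LawfulBEq {i : X // i ∈ A}] (i : {i : X // i ∈ A}) :
    (subListIn l A).count i = l.count i.1 := by
  induction l with
  | nil => simp [subListIn]
  | cons a l ih =>
    by_cases h : a ∈ A
    · rw [subListIn_cons_of_mem h, List.count_cons, List.count_cons, ih]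
      simp [Subtype.ext_iff]
    · have : a ≠ i.1 := fun e => h (e ▸ i.2)
      rw [subListIn_cons_of_notMem h, ih, List.count_cons_of_ne this]

lemma length_subListIn_map_congr {ι X : Type*} [DecidableEq X] (A : Finset X) (l : List ι)
    (x y : ι → X) (h : ∀ t ∈ l, x t ∈ A ↔ y t ∈ A) :
    (subListIn (l.map x) A).length = (subListIn (l.map y) A).length := by
  induction l with
  | nil => rfl
  | cons t l ih =>
    have ht := h t (by simp)
    have := ih fun s hs => h s (by simp [hs])
    by_cases hx : x t ∈ A
    · simp [subListIn_cons_of_mem hx, subListIn_cons_of_mem (ht.1 hx), this]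
    · simp [subListIn_cons_of_notMem hx, subListIn_cons_of_notMem (mt ht.2 hx), this]

lemma length_subListIn_le {X : Type*} [DecidableEq X] (l : List X) (A : Finset X) :
    (subListIn l A).length ≤ l.length :=
  List.length_filterMap_le _ _

/-- A sequence is determined by its block labels and its subsequences in the blocks. -/
lemma map_eq_of_subListIn_eq {ι κ X : Type*} [DecidableEq X] (A : κ → Finset X)
    (hcover : ∀ i : X, ∃ k, i ∈ A k) (l : List ι) (x y : ι → X)
    (h : ∀ t ∈ l, ∀ k, x t ∈ A k ↔ y t ∈ A k)
    (hs : ∀ k, subListIn (l.map x) (A k) = subListIn (l.map y) (A k)) :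
    l.map x = l.map y := by
  induction l with
  | nil => rfl
  | cons t l ih =>
    simp only [List.map_cons] at hs ⊢
    have ht := h t (by simp)
    have hxy : x t = y t := by
      obtain ⟨k, hk⟩ := hcover (x t)
      have := hs k
      rw [subListIn_cons_of_mem hk, subListIn_cons_of_mem ((ht k).1 hk)] at this
      simpa using (List.cons.inj this).1
    rw [hxy, ih (fun s hs' => h s (by simp [hs'])) fun k => ?_]
    have := hs k
    by_cases hk : x t ∈ A k
    · rw [subListIn_cons_of_mem hk, subListIn_cons_of_mem ((ht k).1 hk)] at this
      exact (List.cons.inj this).2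
    · rwa [subListIn_cons_of_notMem hk, subListIn_cons_of_notMem (mt (ht k).2 hk)] at this

/-- The product of the transition weights along a path. -/
noncomputable def pathWeight {B : Type*} (Q : B → B → ℝ) (l : List B) : ℝ :=
  ((l.zip l.tail).map fun p => Q p.1 p.2).prod

lemma pathWeight_eq_prod {B : Type*} [Fintype B] [DecidableEq B] (Q : B → B → ℝ) (l : List B) :
    pathWeight Q l = ∏ i, ∏ j, Q i j ^ pairCount l i j := by
  rw [pathWeight, Finset.prod_list_map_count,
    ← Fintype.prod_prod_type' fun i j => Q i j ^ pairCount l i j]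
  rw [Finset.prod_subset (Finset.subset_univ _) fun p _ hp => ?_]
  · refine Finset.prod_congr rfl fun p _ => ?_
    rw [pairCount]
    congr!
  · have hp' : p ∉ l.zip l.tail := by simpa using hp
    convert pow_zero (Q p.1 p.2)
    refine List.countP_eq_zero.2 fun q hq => ?_
    simpa using ne_of_mem_of_not_mem hq hp'

lemma pathWeight_nonneg {B : Type*} [Fintype B] [DecidableEq B] {Q : B → B → ℝ}
    (hQ : ∀ i j, 0 ≤ Q i j) (l : List B) : 0 ≤ pathWeight Q l := by
  rw [pathWeight_eq_prod]
  exact Finset.prod_nonneg fun i _ => Finset.prod_nonneg fun j _ => pow_nonneg (hQ i j) _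

lemma sum_ofFn_succ {B : Type*} [Fintype B] (N : ℕ) (g : List B → ℝ) :
    ∑ f : Fin (N + 1) → B, g (List.ofFn f) = ∑ b, ∑ f : Fin N → B, g (b :: List.ofFn f) := by
  rw [← Fintype.sum_prod_type' fun b (f : Fin N → B) => g (b :: List.ofFn f),
    ← (Fin.consEquiv fun _ => B).sum_comp]
  simp [Fin.consEquiv, List.ofFn_succ]

lemma sum_pathWeight_cons_le_one {B : Type*} [Fintype B] {Q : B → B → ℝ}
    (hQ : ∀ i j, 0 ≤ Q i j) (hQ1 : ∀ i, ∑ j, Q i j ≤ 1) (N : ℕ) (b : B) :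
    ∑ f : Fin N → B, pathWeight Q (b :: List.ofFn f) ≤ 1 := by
  induction N generalizing b with
  | zero => simp [pathWeight]
  | succ N ih =>
    rw [sum_ofFn_succ N fun l => pathWeight Q (b :: l)]
    refine le_trans (Finset.sum_le_sum fun c _ => ?_) (hQ1 b)
    have : ∀ l, pathWeight Q (b :: c :: l) = Q b c * pathWeight Q (c :: l) := by
      simp [pathWeight]
    simp only [this, ← Finset.mul_sum]
    exact mul_le_of_le_one_right (hQ b c) (ih c)

lemma sum_pathWeight_le_card {B : Type*} [Fintype B] [Nonempty B] {Q : B → B → ℝ}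
    (hQ : ∀ i j, 0 ≤ Q i j) (hQ1 : ∀ i, ∑ j, Q i j ≤ 1) (N : ℕ) :
    ∑ f : Fin N → B, pathWeight Q (List.ofFn f) ≤ Fintype.card B := by
  cases N with
  | zero =>
    simp only [pathWeight, List.ofFn_zero]
    simpa using Nat.one_le_iff_ne_zero.2 (Fintype.card_ne_zero (α := B))
  | succ N =>
    rw [sum_ofFn_succ N (pathWeight Q)]
    refine (Finset.sum_le_sum fun b _ => sum_pathWeight_cons_le_one hQ hQ1 N b).trans ?_
    simp

/-- The empirical Markov entropy (in nats) of a matrix of pair counts, times the length. -/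
noncomputable def countEnt {B : Type*} [Fintype B] (c : B → B → ℕ) : ℝ :=
  ∑ i, ∑ j, ((∑ l, c i l : ℕ) : ℝ) * Real.negMulLog ((c i j : ℝ) / ((∑ l, c i l : ℕ) : ℝ))

lemma div_pow_eq_exp (a s : ℕ) (h : a ≤ s) :
    ((a : ℝ) / s) ^ a = Real.exp (-((s : ℝ) * Real.negMulLog ((a : ℝ) / s))) := by
  rcases Nat.eq_zero_or_pos a with rfl | ha
  · simp
  have ha' : (0 : ℝ) < a := by exact_mod_cast ha
  have hs' : (0 : ℝ) < s := by exact_mod_cast ha.trans_le h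
  rw [← Real.exp_log (pow_pos (div_pos ha' hs') a), Real.log_pow, Real.negMulLog]
  congr 1
  field_simp

lemma prod_empirical_eq_exp {B : Type*} [Fintype B] (c : B → B → ℕ) :
    ∏ i, ∏ j, ((c i j : ℝ) / ((∑ l, c i l : ℕ) : ℝ)) ^ c i j = Real.exp (-countEnt c) := by
  simp only [countEnt, ← Finset.sum_neg_distrib, Real.exp_sum]
  refine Finset.prod_congr rfl fun i _ => Finset.prod_congr rfl fun j _ => ?_
  exact div_pow_eq_exp _ _ (Finset.single_le_sum (f := c i) (fun _ _ => Nat.zero_le _)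
    (Finset.mem_univ j))

/-- The number of sequences with prescribed pair counts is bounded by their empirical entropy. -/
lemma card_filter_pairCount_eq_le {B : Type*} [Fintype B] [DecidableEq B] [Nonempty B] (N : ℕ)
    (c : B → B → ℕ) (T : Finset (Fin N → B)) (hT : ∀ f ∈ T, pairCount (List.ofFn f) = c) :
    (T.card : ℝ) ≤ Fintype.card B * Real.exp (countEnt c) := by
  set Q : B → B → ℝ := fun i j => (c i j : ℝ) / ((∑ l, c i l : ℕ) : ℝ)
  have hQ : ∀ i j, 0 ≤ Q i j := fun i j => by positivity
  have hQ1 : ∀ i, ∑ j, Q i j ≤ 1 := fun i => by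
    simp only [Q, ← Finset.sum_div]
    push_cast
    exact div_self_le_one _
  have h1 : (T.card : ℝ) * Real.exp (-countEnt c) ≤ Fintype.card B := by
    refine le_trans ?_ (sum_pathWeight_le_card hQ hQ1 N)
    calc (T.card : ℝ) * Real.exp (-countEnt c)
        = ∑ f ∈ T, pathWeight Q (List.ofFn f) := by
          rw [← nsmul_eq_mul, ← Finset.sum_const]
          refine Finset.sum_congr rfl fun f hf => ?_
          rw [pathWeight_eq_prod, hT f hf, prod_empirical_eq_exp]
      _ ≤ _ := Finset.sum_le_sum_of_subset_of_nonneg (Finset.subset_univ _)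
          fun f _ _ => pathWeight_nonneg hQ _
  rwa [Real.exp_neg, ← div_eq_mul_inv, div_le_iff₀ (Real.exp_pos _)] at h1

/-- Method of types: sequences whose empirical entropy is at most `M`. -/
lemma card_countEnt_le {B : Type*} [Fintype B] [DecidableEq B] [Nonempty B] (N : ℕ) (M : ℝ) :
    (Nat.card {f : Fin N → B // countEnt (pairCount (List.ofFn f)) ≤ M} : ℝ) ≤
      (N + 1 : ℝ) ^ (Fintype.card B * Fintype.card B) * (Fintype.card B * Real.exp M) := by
  classical
  set T : Finset (Fin N → B) := {f | countEnt (pairCount (List.ofFn f)) ≤ M}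
  have hcard : Nat.card {f : Fin N → B // countEnt (pairCount (List.ofFn f)) ≤ M} = T.card := by
    rw [Nat.card_eq_fintype_card, Fintype.card_subtype]
  let φ : (Fin N → B) → (B → B → ℕ) := fun f => pairCount (List.ofFn f)
  have himg : (T.image φ).card ≤ (N + 1) ^ (Fintype.card B * Fintype.card B) := by
    calc (T.image φ).card
        ≤ (Fintype.piFinset fun _ : B => Fintype.piFinset fun _ : B =>
            Finset.range (N + 1)).card := by
          refine Finset.card_le_card fun c hc => ?_
          obtain ⟨f, -, rfl⟩ := Finset.mem_image.1 hc
          simp only [Fintype.mem_piFinset, Finset.mem_range, Nat.lt_succ_iff]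
          intro i j
          simpa using pairCount_le_length (List.ofFn f) i j
      _ = _ := by simp [pow_mul]
  rw [hcard, Finset.card_eq_sum_card_image φ T, Nat.cast_sum]
  calc ∑ c ∈ T.image φ, ((T.filter fun f => φ f = c).card : ℝ)
      ≤ ∑ c ∈ T.image φ, Fintype.card B * Real.exp M := by
        refine Finset.sum_le_sum fun c hc => ?_
        refine (card_filter_pairCount_eq_le N c _ fun f hf => (Finset.mem_filter.1 hf).2).trans ?_
        obtain ⟨f, hf, rfl⟩ := Finset.mem_image.1 hc
        gcongr
        exact (Finset.mem_filter.1 hf).2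
    _ = (T.image φ).card * (Fintype.card B * Real.exp M) := by simp
    _ ≤ _ := by
        gcongr
        exact_mod_cast himg

lemma sum_mul_scCondEnt {X : Type*} [Fintype X] [DecidableEq X] (P : X → X → ℝ) (π : X → ℝ)
    (hπ : ∀ i, 0 ≤ π i) (A : Finset X) :
    (∑ j ∈ A, π j) * scCondEnt P π A * Real.log 2 =
      ∑ i : {i : X // i ∈ A}, ∑ j : {i : X // i ∈ A},
        π i.1 * Real.negMulLog (stochComp P A i j) := by
  have hlog : Real.log 2 ≠ 0 := (Real.log_pos one_lt_two).ne'
  have hcancel : ∀ i : {i : X // i ∈ A}, (∑ j ∈ A, π j) * (π i.1 / ∑ j ∈ A, π j) = π i.1 := by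
    intro i
    by_cases h : ∑ j ∈ A, π j = 0
    · rw [h, zero_mul, (Finset.sum_eq_zero_iff_of_nonneg fun i _ => hπ i).1 h i.1 i.2]
    · exact mul_div_cancel₀ _ h
  rw [scCondEnt]
  generalize ∑ l ∈ A, π l = s at hcancel ⊢
  simp only [← Finset.sum_neg_distrib, Finset.mul_sum, Finset.sum_mul]
  refine Finset.sum_congr rfl fun i _ => Finset.sum_congr rfl fun j _ => ?_
  rw [Real.negMulLog, Real.logb]
  conv_rhs => rw [← hcancel i]
  field_simp

/-- The frequency of a state in the subsequence of its block, relative to the full length. -/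
lemma abs_stateCount_subListIn_div_sub_lt {X : Type*} [Fintype X] [DecidableEq X] [Nonempty X]
    {P : X → X → ℝ} {π : X → ℝ} {ε : ℝ} (hπ : ∑ i, π i = 1) {y : List X} (hy : y ≠ [])
    (h : SupTypical P π ε y) (A : Finset X) (i : {i : X // i ∈ A}) :
    |(stateCount (subListIn y A) i : ℝ) / y.length - π i.1| < ε + 1 / y.length := by
  have hlen : (subListIn y Finset.univ).length = y.length := by
    clear hy h
    induction y with
    | nil => rfl
    | cons a l ih => simp [subListIn_cons_of_mem (Finset.mem_univ a), ih]
  have hpos : (0 : ℝ) < y.length := by exact_mod_cast List.length_pos_iff.2 hy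
  set u : {i : X // i ∈ (Finset.univ : Finset X)} := ⟨i.1, Finset.mem_univ _⟩
  have h2 := (h Finset.univ Finset.univ_nonempty u u).2
  simp only [hlen, hπ, div_one] at h2
  have hc1 := stateCount_le_count_le (subListIn y Finset.univ) u
  have hc2 := stateCount_le_count_le (subListIn y A) i
  rw [count_subListIn] at hc1 hc2
  have hd : |(stateCount (subListIn y A) i : ℝ) - stateCount (subListIn y Finset.univ) u| ≤ 1 := by
    rw [abs_le]
    have e1 : stateCount (subListIn y A) i ≤ stateCount (subListIn y Finset.univ) u + 1 := by
      exact hc2.1.trans hc1.2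
    have e2 : stateCount (subListIn y Finset.univ) u ≤ stateCount (subListIn y A) i + 1 := by
      exact hc1.1.trans hc2.2
    have e1' : (stateCount (subListIn y A) i : ℝ) ≤ stateCount (subListIn y Finset.univ) u + 1 := by
      exact_mod_cast e1
    have e2' : (stateCount (subListIn y Finset.univ) u : ℝ) ≤ stateCount (subListIn y A) i + 1 := by
      exact_mod_cast e2
    constructor <;> linarith
  have hd' : |(stateCount (subListIn y A) i : ℝ) / y.length -
      stateCount (subListIn y Finset.univ) u / y.length| ≤ 1 / y.length := by
    rw [← sub_div, abs_div, abs_of_pos hpos]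
    gcongr
  have := abs_sub_le ((stateCount (subListIn y A) i : ℝ) / y.length)
    (stateCount (subListIn y Finset.univ) u / y.length) (π i.1)
  linarith

/-- For Supremus typical sequences the empirical entropy of each block subsequence is close to
the entropy of the stochastic complement. -/
lemma exists_countEnt_subListIn_le {X : Type*} [Fintype X] [DecidableEq X] [Nonempty X]
    (P : X → X → ℝ) (π : X → ℝ) (hπ : ∑ i, π i = 1) (A : Finset X) (hA : A.Nonempty)
    {η : ℝ} (hη : 0 < η) :
    ∃ δ > (0 : ℝ), ∀ ε : ℝ, ∀ y : List X, y ≠ [] → ε + 1 / y.length ≤ δ → SupTypical P π ε y →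
      countEnt (pairCount (subListIn y A)) ≤ y.length *
        ((∑ i : {i : X // i ∈ A}, ∑ j : {i : X // i ∈ A},
          π i.1 * Real.negMulLog (stochComp P A i j)) + η) := by
  let F : ({i : X // i ∈ A} → ℝ) × ({i : X // i ∈ A} → {i : X // i ∈ A} → ℝ) → ℝ :=
    fun p => ∑ i, ∑ j, p.1 i * Real.negMulLog (p.2 i j)
  have hF : Continuous F := by
    refine continuous_finsetSum _ fun i _ => continuous_finsetSum _ fun j _ => ?_
    exact ((continuous_apply i).comp continuous_fst).mul (Real.continuous_negMulLog.comp
      ((continuous_apply j).comp ((continuous_apply i).comp continuous_snd)))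
  obtain ⟨δ, hδ, hclose⟩ := Metric.continuous_iff.1 hF (fun i => π i.1, stochComp P A) η hη
  refine ⟨δ, hδ, fun ε y hy hε h => ?_⟩
  have hpos : (0 : ℝ) < y.length := by exact_mod_cast List.length_pos_iff.2 hy
  have hεδ : ε < δ := by
    have : 0 < 1 / (y.length : ℝ) := by positivity
    linarith
  have hd := hclose
    (fun i => (stateCount (subListIn y A) i : ℝ) / y.length,
      fun i j => (pairCount (subListIn y A) i j : ℝ) / stateCount (subListIn y A) i) (by
    refine max_lt ((dist_pi_lt_iff hδ).2 fun i => ?_) ((dist_pi_lt_iff hδ).2 fun i =>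
      (dist_pi_lt_iff hδ).2 fun j => ?_)
    · exact (abs_stateCount_subListIn_div_sub_lt hπ hy h A i).trans_le hε
    · exact ((h A hA i j).1).trans hεδ)
  have hle := (abs_lt.1 hd).2
  have heq : countEnt (pairCount (subListIn y A)) = y.length *
      F (fun i => (stateCount (subListIn y A) i : ℝ) / y.length,
        fun i j => (pairCount (subListIn y A) i j : ℝ) / stateCount (subListIn y A) i) := by
    simp only [F, countEnt, Finset.mul_sum]
    refine Finset.sum_congr rfl fun i _ => Finset.sum_congr rfl fun j _ => ?_
    rw [← mul_assoc, mul_div_cancel₀ _ hpos.ne']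
    rfl
  rw [heq]
  refine mul_le_mul_of_nonneg_left ?_ hpos.le
  change _ ≤ F (fun i => π i.1, stochComp P A) + η
  linarith

/-- Sequences with given block labels inject into the product of the block subsequences. -/
lemma card_le_prod_card {X : Type*} [Fintype X] [DecidableEq X] {m n : ℕ}
    (A : Fin m → Finset X) (hcover : ∀ i : X, ∃ k, i ∈ A k) (x : Fin n → X)
    (p : (Fin n → X) → Prop) (q : ∀ k, List {i : X // i ∈ A k} → Prop)
    (hpq : ∀ y, p y → ∀ k, q k (subListIn (List.ofFn y) (A k))) :
    Nat.card {y : Fin n → X // p y ∧ ∀ (l : Fin n) (k : Fin m), y l ∈ A k ↔ x l ∈ A k} ≤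
      ∏ k, Nat.card {f : Fin (subListIn (List.ofFn x) (A k)).length → {i : X // i ∈ A k} //
        q k (List.ofFn f)} := by
  rw [← Nat.card_pi]
  have hlen : ∀ y : {y : Fin n → X // p y ∧ ∀ (l : Fin n) (k : Fin m), y l ∈ A k ↔ x l ∈ A k},
      ∀ k, (subListIn (List.ofFn x) (A k)).length = (subListIn (List.ofFn y.1) (A k)).length := by
    intro y k
    rw [List.ofFn_eq_map, List.ofFn_eq_map]
    exact length_subListIn_map_congr _ _ _ _ fun t _ => (y.2.2 t k).symm
  have hof : ∀ y k, List.ofFn (fun t => (subListIn (List.ofFn y.1) (A k)).get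
      (Fin.cast (hlen y k) t)) = subListIn (List.ofFn y.1) (A k) := by
    intro y k
    rw [← List.ofFn_congr (hlen y k).symm]
    exact List.ofFn_get _
  refine Nat.card_le_card_of_injective (fun y k => ⟨fun t =>
    (subListIn (List.ofFn y.1) (A k)).get (Fin.cast (hlen y k) t), by
      rw [hof]; exact hpq _ y.2.1 k⟩) fun y z hyz => Subtype.ext (List.ofFn_injective ?_)
  have hs : ∀ k, subListIn (List.ofFn y.1) (A k) = subListIn (List.ofFn z.1) (A k) := by
    intro k
    rw [← hof y k, ← hof z k]
    exact congrArg List.ofFn (Subtype.ext_iff.1 (congrFun hyz k))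
  simp only [List.ofFn_eq_map] at hs ⊢
  exact map_eq_of_subListIn_eq A hcover _ _ _
    (fun t _ k => (y.2.2 t k).trans (z.2.2 t k).symm) hs

lemma eventually_const_mul_pow_lt_exp (C : ℝ) (p : ℕ) {b : ℝ} (hb : 0 < b) :
    ∀ᶠ n : ℕ in Filter.atTop, C * (n + 1 : ℝ) ^ p < Real.exp (n * b) := by
  have h0 : Filter.Tendsto (fun n : ℕ => (n + 1 : ℝ)) Filter.atTop Filter.atTop :=
    Filter.tendsto_atTop_add_const_right _ _ tendsto_natCast_atTop_atTop
  have hc : 0 < 1 / ((|C| + 1) * Real.exp b) := by positivity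
  filter_upwards [((isLittleO_pow_exp_pos_mul_atTop p hb).comp_tendsto h0).bound hc] with n hn
  have hpow : (0 : ℝ) < (n + 1 : ℝ) ^ p := by positivity
  simp only [Function.comp, Real.norm_eq_abs, Real.abs_exp, abs_of_pos hpow] at hn
  rw [show b * ((n : ℝ) + 1) = n * b + b by ring, Real.exp_add, one_div_mul_eq_div,
    mul_div_mul_right _ _ (Real.exp_pos b).ne', le_div_iff₀ (by positivity)] at hn
  nlinarith [le_abs_self C]

/-- Typicality lemma for Supremus typical sequences relative to a partition
`𝒳 = A_1 ⊔ … ⊔ A_m`: the number of Supremus ε-typical sequences agreeing with `x`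
on the blocks of the partition is less than
`2^{n(∑_k (∑_{j∈A_k} p_j) H(S_k|π_k) + η)}`. -/
theorem stmt19 {X : Type*} [Fintype X] [DecidableEq X] [Nonempty X]
    (P : X → X → ℝ) (π : X → ℝ)
    (hP : IsStochasticMat P) (hirr : IsIrreducibleMat P) (hπ : IsInvariantDist P π)
    (m : ℕ) (A : Fin m → Finset X)
    (hne : ∀ k, (A k).Nonempty)
    (hdisj : ∀ k l, k ≠ l → Disjoint (A k) (A l))
    (hcover : ∀ i : X, ∃ k, i ∈ A k) :
    ∀ η > (0 : ℝ), ∃ ε₀ > (0 : ℝ), ∃ N₀ : ℕ+, ∀ ε : ℝ, 0 < ε → ε < ε₀ →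
      ∀ n : ℕ, (N₀ : ℕ) < n →
      ∀ x : Fin n → X, SupTypical P π ε (List.ofFn x) →
        (Nat.card {y : Fin n → X // SupTypical P π ε (List.ofFn y) ∧
            ∀ (l : Fin n) (k : Fin m), y l ∈ A k ↔ x l ∈ A k} : ℝ) <
          (2 : ℝ) ^ ((n : ℝ) *
            ((∑ k, (∑ j ∈ A k, π j) * scCondEnt P π (A k)) + η)) := by
  intro η hη
  have hlog : 0 < Real.log 2 := Real.log_pos one_lt_two
  set b : ℝ := η * Real.log 2 / 2
  have hb : 0 < b := by positivity
  set η' : ℝ := b / (m + 1)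
  have hη' : 0 < η' := by positivity
  set d : ℕ := Fintype.card X
  set E : Fin m → ℝ := fun k => ∑ i : {i : X // i ∈ A k}, ∑ j : {i : X // i ∈ A k},
    π i.1 * Real.negMulLog (stochComp P (A k) i j)
  choose δ hδ hent using fun k => exists_countEnt_subListIn_le P π hπ.2.1 (A k) (hne k) hη'
  obtain ⟨δ₀, hδ₀, hδ₀le⟩ : ∃ δ₀ > 0, ∀ k, δ₀ ≤ δ k := by
    have h1 : ∀ᶠ t : ℝ in nhdsWithin 0 (Set.Ioi 0), ∀ k, t ≤ δ k := Filter.eventually_all.2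
      fun k => Filter.Eventually.filter_mono nhdsWithin_le_nhds (eventually_le_nhds (hδ k))
    exact (eventually_mem_nhdsWithin.and h1).exists
  obtain ⟨N₁, hN₁⟩ := Filter.eventually_atTop.1
    (eventually_const_mul_pow_lt_exp ((d : ℝ) ^ m) (d * d * m) hb)
  obtain ⟨N₂, hN₂⟩ := exists_nat_gt (2 / δ₀)
  refine ⟨δ₀ / 2, by positivity, ⟨N₁ + N₂ + 1, by omega⟩, fun ε hε hεδ n hn x hx => ?_⟩
  simp only [PNat.mk_coe] at hn
  have hn0 : (0 : ℝ) < n := by exact_mod_cast (by omega : 0 < n)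
  have hninv : 1 / (n : ℝ) ≤ δ₀ / 2 := by
    have : (N₂ : ℝ) ≤ n := by exact_mod_cast (by omega : N₂ ≤ n)
    rw [div_lt_iff₀ hδ₀] at hN₂
    rw [div_le_iff₀ hn0]
    nlinarith
  have hcard := card_le_prod_card A hcover x (fun y => SupTypical P π ε (List.ofFn y))
    (fun k l => countEnt (pairCount l) ≤ n * (E k + η')) (by
      intro y hy k
      have := hent k ε (List.ofFn y) (by
        rw [Ne, List.ofFn_eq_nil_iff]; omega) (by
        rw [List.length_ofFn]; linarith [hδ₀le k]) hy
      rwa [List.length_ofFn] at this)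
  have hblock : ∀ k, (Nat.card {f : Fin (subListIn (List.ofFn x) (A k)).length →
      {i : X // i ∈ A k} // countEnt (pairCount (List.ofFn f)) ≤ n * (E k + η')} : ℝ) ≤
      (n + 1 : ℝ) ^ (d * d) * (d * Real.exp (n * (E k + η'))) := by
    intro k
    have : Nonempty {i : X // i ∈ A k} := (hne k).to_subtype
    have hd : Fintype.card {i : X // i ∈ A k} ≤ d := Fintype.card_subtype_le _
    have hl : (subListIn (List.ofFn x) (A k)).length ≤ n := by
      simpa using length_subListIn_le (List.ofFn x) (A k)
    refine (card_countEnt_le _ _).trans ?_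
    have h1 : (1 : ℝ) ≤ n + 1 := by linarith
    have h2 : ((subListIn (List.ofFn x) (A k)).length + 1 : ℝ) ^
        (Fintype.card {i : X // i ∈ A k} * Fintype.card {i : X // i ∈ A k}) ≤
        (n + 1 : ℝ) ^ (d * d) :=
      (pow_le_pow_left₀ (by positivity) (by gcongr) _).trans
        (pow_le_pow_right₀ h1 (Nat.mul_le_mul hd hd))
    gcongr
  have hprod : (∏ k, (n + 1 : ℝ) ^ (d * d) * (d * Real.exp (n * (E k + η')))) =
      ((d : ℝ) ^ m * (n + 1 : ℝ) ^ (d * d * m)) * Real.exp (n * (∑ k, E k + m * η')) := by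
    rw [Finset.prod_mul_distrib, Finset.prod_mul_distrib, ← Real.exp_sum, ← Finset.mul_sum,
      Finset.sum_add_distrib]
    simp [pow_mul]
    ring
  have hE : (∑ k, (∑ j ∈ A k, π j) * scCondEnt P π (A k)) * Real.log 2 = ∑ k, E k := by
    rw [Finset.sum_mul]
    exact Finset.sum_congr rfl fun k _ => sum_mul_scCondEnt P π hπ.1 (A k)
  have hmη : m * η' ≤ b := by
    rw [mul_div_assoc', div_le_iff₀ (by positivity)]
    nlinarith
  calc _ ≤ ((∏ k, Nat.card {f : Fin (subListIn (List.ofFn x) (A k)).length →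
        {i : X // i ∈ A k} // countEnt (pairCount (List.ofFn f)) ≤ n * (E k + η')} : ℕ) : ℝ) := by
        exact_mod_cast hcard
    _ ≤ ∏ k, (n + 1 : ℝ) ^ (d * d) * (d * Real.exp (n * (E k + η'))) := by
        rw [Nat.cast_prod]
        exact Finset.prod_le_prod (fun _ _ => Nat.cast_nonneg _) fun k _ => hblock k
    _ = ((d : ℝ) ^ m * (n + 1 : ℝ) ^ (d * d * m)) * Real.exp (n * (∑ k, E k + m * η')) := hprod
    _ < Real.exp (n * b) * Real.exp (n * (∑ k, E k + m * η')) := by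
        gcongr
        exact hN₁ n (by omega)
    _ ≤ Real.exp (n * b) * Real.exp (n * (∑ k, E k + b)) := by gcongr
    _ = _ := by
        rw [← Real.exp_add, Real.rpow_def_of_pos two_pos, ← hE]
        congr 1
        simp only [b]
        ring
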